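/- Let (g, φ) be a LieDer pair over a field K of characteristic 0 with bracket ω. Suppose the third LieDer cohomology with adjoint coefficients vanishes, i.e. every 3-cocycle (F, G) ∈ C^3(g;g) × C^2(g;g) (meaning d F = 0 and d G − δ F = 0) is of the form (d f, d h + δ f) for some 2-cochain (f, h) ∈ C^2(g;g) × C^1(g;g). Then every 2-cocycle (ω_1, φ_1) of (g, φ) with adjoint coefficients (d ω_1 = 0 and d φ_1 + δ ω_1 = 0) is the infinitesimal of some 1-parameter formal deformation of (g, φ): there exist skew-symmetric bilinear maps (ω_i)_{i≥2} and linear maps (φ_i)_{i≥2} such that (ω_i, φ_i)_{i≥0} with ω_0 = ω, φ_0 = φ and the given (ω_1, φ_1) is a 1-parameter formal deformation of (g, φ). -/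

import Mathlib

section FormalDeformation

open Finset LinearMap

variable {R M : Type*} [CommRing R] [AddCommGroup M] [Module R M]

/-- The coefficient of `t ^ n` in the Jacobiator of the bracket `∑ i, t ^ i • ω i`. -/
def jacobiatorCoeff (ω : ℕ → M →ₗ[R] M →ₗ[R] M) (n : ℕ) : M →ₗ[R] M →ₗ[R] M →ₗ[R] M :=
  ∑ p ∈ antidiagonal n,
    ((ω p.2).compr₂ (ω p.1) + (lflip.comp ((ω p.2).compr₂ (ω p.1))).flip +
      lflip.comp ((ω p.2).compr₂ (ω p.1)).flip)

/-- The coefficient of `t ^ n` in the failure of `∑ i, t ^ i • φ i` to be a derivation of the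
bracket `∑ i, t ^ i • ω i`. -/
def leibnizDefectCoeff (ω : ℕ → M →ₗ[R] M →ₗ[R] M) (φ : ℕ → M →ₗ[R] M) (n : ℕ) :
    M →ₗ[R] M →ₗ[R] M :=
  ∑ p ∈ antidiagonal n,
    ((ω p.2).compr₂ (φ p.1) - (ω p.2).comp (φ p.1) - (ω p.2).compl₂ (φ p.1))

theorem jacobiatorCoeff_apply (ω : ℕ → M →ₗ[R] M →ₗ[R] M) (n : ℕ) (x y z : M) :
    jacobiatorCoeff ω n x y z = ∑ p ∈ antidiagonal n,
      (ω p.1 (ω p.2 x y) z + ω p.1 (ω p.2 y z) x + ω p.1 (ω p.2 z x) y) := by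
  simp [jacobiatorCoeff, LinearMap.sum_apply]

theorem leibnizDefectCoeff_apply (ω : ℕ → M →ₗ[R] M →ₗ[R] M) (φ : ℕ → M →ₗ[R] M) (n : ℕ)
    (x y : M) :
    leibnizDefectCoeff ω φ n x y = ∑ p ∈ antidiagonal n,
      (φ p.1 (ω p.2 x y) - ω p.2 (φ p.1 x) y - ω p.2 x (φ p.1 y)) := by
  simp [leibnizDefectCoeff, LinearMap.sum_apply]

/-- The sum of `f i j k` over all `i + j + k = n`. -/
def tripleSum (n : ℕ) (f : ℕ → ℕ → ℕ → M) : M :=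
  ∑ p ∈ antidiagonal n, ∑ q ∈ antidiagonal p.2, f p.1 q.1 q.2

theorem tripleSum_swap_right (n : ℕ) (f : ℕ → ℕ → ℕ → M) :
    tripleSum n (fun i j k => f i k j) = tripleSum n f :=
  sum_congr rfl fun p _ => Nat.sum_antidiagonal_swap (f := fun q => f p.1 q.1 q.2)

theorem tripleSum_swap_left (n : ℕ) (f : ℕ → ℕ → ℕ → M) :
    tripleSum n (fun i j k => f j i k) = tripleSum n f := by
  unfold tripleSum
  rw [sum_sigma', sum_sigma']
  refine sum_nbij' (fun a => ⟨(a.2.1, a.1.1 + a.2.2), (a.1.1, a.2.2)⟩)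
    (fun a => ⟨(a.2.1, a.1.1 + a.2.2), (a.1.1, a.2.2)⟩) ?_ ?_ ?_ ?_ ?_ <;>
  simp only [mem_sigma, HasAntidiagonal.mem_antidiagonal, Sigma.forall, Prod.forall] <;> grind

theorem tripleSum_rotate (n : ℕ) (f : ℕ → ℕ → ℕ → M) :
    tripleSum n (fun i j k => f j k i) = tripleSum n f := by
  rw [tripleSum_swap_left n fun i j k => f i k j, tripleSum_swap_right]

theorem tripleSum_add (n : ℕ) (f f' : ℕ → ℕ → ℕ → M) :
    tripleSum n (fun i j k => f i j k + f' i j k) = tripleSum n f + tripleSum n f' := by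
  simp [tripleSum, sum_add_distrib]

theorem tripleSum_neg (n : ℕ) (f : ℕ → ℕ → ℕ → M) :
    tripleSum n (fun i j k => -f i j k) = -tripleSum n f := by
  simp [tripleSum]

theorem tripleSum_sub (n : ℕ) (f f' : ℕ → ℕ → ℕ → M) :
    tripleSum n (fun i j k => f i j k - f' i j k) = tripleSum n f - tripleSum n f' := by
  simp [tripleSum]

theorem sum_antidiagonal_eq_of_forall_lt {n : ℕ} (f : ℕ → ℕ → M)
    (hf : ∀ i j, j < n → f i j = 0) : ∑ p ∈ antidiagonal n, f p.1 p.2 = f 0 n := by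
  refine sum_eq_single (0, n) (fun p hp hne => hf _ _ ?_) (by simp)
  rw [HasAntidiagonal.mem_antidiagonal] at hp
  rcases p with ⟨i, j⟩
  simp only [ne_eq, Prod.mk.injEq] at hne hp
  omega

variable {ω : ℕ → M →ₗ[R] M →ₗ[R] M} {φ : ℕ → M →ₗ[R] M}

theorem jacobiatorCoeff_swap_left (hs : ∀ i x y, ω i x y = -ω i y x) (n : ℕ) (x y z : M) :
    jacobiatorCoeff ω n x y z = -jacobiatorCoeff ω n y x z := by
  simp only [jacobiatorCoeff_apply, ← sum_neg_distrib]
  refine sum_congr rfl fun p _ => ?_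
  rw [hs p.2 y x, hs p.2 x z, hs p.2 z y]
  simp only [map_neg, LinearMap.neg_apply]
  abel

theorem jacobiatorCoeff_swap_right (hs : ∀ i x y, ω i x y = -ω i y x) (n : ℕ) (x y z : M) :
    jacobiatorCoeff ω n x z y = -jacobiatorCoeff ω n x y z := by
  simp only [jacobiatorCoeff_apply, ← sum_neg_distrib]
  refine sum_congr rfl fun p _ => ?_
  rw [hs p.2 x z, hs p.2 z y, hs p.2 y x]
  simp only [map_neg, LinearMap.neg_apply]
  abel

theorem leibnizDefectCoeff_swap (hs : ∀ i x y, ω i x y = -ω i y x) (n : ℕ) (x y : M) :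
    leibnizDefectCoeff ω φ n x y = -leibnizDefectCoeff ω φ n y x := by
  simp only [leibnizDefectCoeff_apply, ← sum_neg_distrib]
  refine sum_congr rfl fun p _ => ?_
  rw [hs p.2 y x, hs p.2 (φ p.1 y) x, hs p.2 y]
  simp only [map_neg]
  abel

/-- The lowest-order nonzero Jacobiator coefficient is a Chevalley–Eilenberg cocycle. -/
theorem jacobiatorCoeff_cocycle (hs : ∀ i x y, ω i x y = -ω i y x) {n : ℕ}
    (hJ : ∀ m < n, jacobiatorCoeff ω m = 0) (x y z w : M) :
    ω 0 x (jacobiatorCoeff ω n y z w) - ω 0 y (jacobiatorCoeff ω n x z w)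
      + ω 0 z (jacobiatorCoeff ω n x y w) - ω 0 w (jacobiatorCoeff ω n x y z)
      - jacobiatorCoeff ω n (ω 0 x y) z w + jacobiatorCoeff ω n (ω 0 x z) y w
      - jacobiatorCoeff ω n (ω 0 x w) y z - jacobiatorCoeff ω n (ω 0 y z) x w
      + jacobiatorCoeff ω n (ω 0 y w) x z - jacobiatorCoeff ω n (ω 0 z w) x y = 0 := by
  let U (a b c d : M) : M := tripleSum n fun i j k => ω i (ω j (ω k a b) c) d
  let V (a b c d : M) : M := tripleSum n fun i j k => ω i (ω j a b) (ω k c d)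
  have hU (a b c d : M) : U a b c d = -U b a c d := by
    simp only [U, ← tripleSum_neg]
    congr! 4 with i j k
    rw [hs k a b]
    simp
  have hV (a b c d : M) : V a b c d = -V c d a b := by
    simp only [V, ← tripleSum_neg]
    rw [← tripleSum_swap_right]
    congr! 4 with i j k
    rw [hs i]
  have outer (a b c d : M) :
      ω 0 a (jacobiatorCoeff ω n b c d) = -(U b c d a + U c d b a + U d b c a) := by
    rw [← sum_antidiagonal_eq_of_forall_lt (fun i j => ω i a (jacobiatorCoeff ω j b c d))
      fun i j hj => by simp [hJ j hj]]
    simp only [U, ← tripleSum_add, ← tripleSum_neg]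
    refine sum_congr rfl fun p _ => ?_
    rw [hs, jacobiatorCoeff_apply]
    simp only [map_sum, LinearMap.sum_apply, ← sum_neg_distrib]
    refine sum_congr rfl fun q _ => ?_
    simp only [map_add, LinearMap.add_apply]
  have inner (a b c d : M) :
      jacobiatorCoeff ω n (ω 0 a b) c d = U a b c d + V c d a b - U a b d c := by
    rw [← sum_antidiagonal_eq_of_forall_lt (fun i j => jacobiatorCoeff ω j (ω i a b) c d)
      fun i j hj => by simp [hJ j hj]]
    simp only [U, V]
    rw [← tripleSum_rotate n fun i j k => ω i (ω j (ω k a b) c) d,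
      ← tripleSum_rotate n fun i j k => ω i (ω j c d) (ω k a b),
      ← tripleSum_rotate n fun i j k => ω i (ω j (ω k a b) d) c]
    simp only [← tripleSum_add, ← tripleSum_sub]
    refine sum_congr rfl fun p _ => ?_
    rw [jacobiatorCoeff_apply]
    refine sum_congr rfl fun q _ => ?_
    rw [hs q.2 d]
    simp only [map_neg, LinearMap.neg_apply]
    abel
  simp only [outer, inner]
  rw [hV z w x y, hV y w x z, hV y z x w, hU w y z x, hU w x z y, hU w x y z, hU z x y w]
  abel

/-- If all Jacobiator and Leibniz defect coefficients below `n` vanish, those of order `n` satisfy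
the second component of the LieDer cocycle equation. -/
theorem leibnizDefectCoeff_cocycle (hs : ∀ i x y, ω i x y = -ω i y x) {n : ℕ}
    (hJ : ∀ m < n, jacobiatorCoeff ω m = 0) (hD : ∀ m < n, leibnizDefectCoeff ω φ m = 0)
    (x y z : M) :
    (ω 0 x (leibnizDefectCoeff ω φ n y z) - ω 0 y (leibnizDefectCoeff ω φ n x z)
      + ω 0 z (leibnizDefectCoeff ω φ n x y)
      - leibnizDefectCoeff ω φ n (ω 0 x y) z + leibnizDefectCoeff ω φ n (ω 0 x z) y
      - leibnizDefectCoeff ω φ n (ω 0 y z) x)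
      - (jacobiatorCoeff ω n (φ 0 x) y z + jacobiatorCoeff ω n x (φ 0 y) z
        + jacobiatorCoeff ω n x y (φ 0 z) - φ 0 (jacobiatorCoeff ω n x y z)) = 0 := by
  let P (a b c : M) : M := tripleSum n fun i j k => φ i (ω j (ω k a b) c)
  let Q (a b c : M) : M := tripleSum n fun i j k => ω j (φ i (ω k a b)) c
  let S (a b c : M) : M := tripleSum n fun i j k => ω j (ω k a b) (φ i c)
  let T (a b c : M) : M := tripleSum n fun i j k => ω j (ω k (φ i a) b) c
  have hP (a b c : M) : P a b c = -P b a c := by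
    simp only [P, ← tripleSum_neg]
    congr! 4 with i j k
    rw [hs k a b]
    simp
  have bracket_defect (a b c : M) :
      ω 0 a (leibnizDefectCoeff ω φ n b c) = -(Q b c a - T b c a + T c b a) := by
    rw [← sum_antidiagonal_eq_of_forall_lt (fun i j => ω i a (leibnizDefectCoeff ω φ j b c))
      fun i j hj => by simp [hD j hj]]
    simp only [Q, T]
    rw [← tripleSum_swap_left n fun i j k => ω j (φ i (ω k b c)) a,
      ← tripleSum_swap_left n fun i j k => ω j (ω k (φ i b) c) a,
      ← tripleSum_swap_left n fun i j k => ω j (ω k (φ i c) b) a]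
    simp only [← tripleSum_add, ← tripleSum_sub, ← tripleSum_neg]
    refine sum_congr rfl fun p _ => ?_
    rw [hs, leibnizDefectCoeff_apply]
    simp only [map_sum, LinearMap.sum_apply, ← sum_neg_distrib]
    refine sum_congr rfl fun q _ => ?_
    rw [hs q.2 b (φ q.1 c)]
    simp only [map_sub, map_neg, LinearMap.sub_apply, LinearMap.neg_apply]
    abel
  have defect_bracket (a b c : M) :
      leibnizDefectCoeff ω φ n (ω 0 a b) c = P a b c - Q a b c - S a b c := by
    rw [← sum_antidiagonal_eq_of_forall_lt (fun i j => leibnizDefectCoeff ω φ j (ω i a b) c)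
      fun i j hj => by simp [hD j hj]]
    simp only [P, Q, S]
    rw [← tripleSum_rotate n fun i j k => φ i (ω j (ω k a b) c),
      ← tripleSum_rotate n fun i j k => ω j (φ i (ω k a b)) c,
      ← tripleSum_rotate n fun i j k => ω j (ω k a b) (φ i c)]
    simp only [← tripleSum_sub]
    refine sum_congr rfl fun p _ => ?_
    rw [leibnizDefectCoeff_apply]
  have map_jacobiator (a b c : M) :
      φ 0 (jacobiatorCoeff ω n a b c) = P a b c + P b c a + P c a b := by
    rw [← sum_antidiagonal_eq_of_forall_lt (fun i j => φ i (jacobiatorCoeff ω j a b c))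
      fun i j hj => by simp [hJ j hj]]
    simp only [P, ← tripleSum_add]
    refine sum_congr rfl fun p _ => ?_
    rw [jacobiatorCoeff_apply]
    simp
  have jacobiator_map (a b c : M) :
      jacobiatorCoeff ω n (φ 0 a) b c = T a b c + S b c a - T a c b := by
    rw [← sum_antidiagonal_eq_of_forall_lt (fun i j => jacobiatorCoeff ω j (φ i a) b c)
      fun i j hj => by simp [hJ j hj]]
    simp only [T, S, ← tripleSum_add, ← tripleSum_sub]
    refine sum_congr rfl fun p _ => ?_
    rw [jacobiatorCoeff_apply]
    refine sum_congr rfl fun q _ => ?_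
    rw [hs q.2 c]
    simp only [map_neg, LinearMap.neg_apply]
    abel
  rw [jacobiatorCoeff_swap_left hs n x (φ 0 y) z, jacobiatorCoeff_swap_right hs n x (φ 0 z) y,
    jacobiatorCoeff_swap_left hs n x (φ 0 z) y]
  simp only [bracket_defect, defect_bracket, map_jacobiator, jacobiator_map]
  rw [hP z x y]
  abel

theorem jacobiatorCoeff_congr {ω' : ℕ → M →ₗ[R] M →ₗ[R] M} {n : ℕ}
    (h : ∀ i ≤ n, ω i = ω' i) : jacobiatorCoeff ω n = jacobiatorCoeff ω' n := by
  refine sum_congr rfl fun p hp => ?_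
  rw [h p.1 (HasAntidiagonal.antidiagonal.fst_le hp),
    h p.2 (HasAntidiagonal.antidiagonal.snd_le hp)]

theorem leibnizDefectCoeff_congr {ω' : ℕ → M →ₗ[R] M →ₗ[R] M} {φ' : ℕ → M →ₗ[R] M} {n : ℕ}
    (h : ∀ i ≤ n, ω i = ω' i) (h' : ∀ i ≤ n, φ i = φ' i) :
    leibnizDefectCoeff ω φ n = leibnizDefectCoeff ω' φ' n := by
  refine sum_congr rfl fun p hp => ?_
  rw [h' p.1 (HasAntidiagonal.antidiagonal.fst_le hp),
    h p.2 (HasAntidiagonal.antidiagonal.snd_le hp)]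

theorem jacobiatorCoeff_update {n : ℕ} (hω : ω (n + 2) = 0) (f : M →ₗ[R] M →ₗ[R] M)
    (x y z : M) :
    jacobiatorCoeff (Function.update ω (n + 2) f) (n + 2) x y z =
      jacobiatorCoeff ω (n + 2) x y z
        + (ω 0 (f x y) z + ω 0 (f y z) x + ω 0 (f z x) y)
        + (f (ω 0 x y) z + f (ω 0 y z) x + f (ω 0 z x) y) := by
  have hne {i : ℕ} (hi : i < n + 2) : Function.update ω (n + 2) f i = ω i :=
    Function.update_of_ne hi.ne _ _
  simp only [jacobiatorCoeff_apply, Nat.antidiagonal_succ_succ', sum_cons, sum_map]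
  rw [sum_congr (g := fun p => ω (p.1 + 1) (ω (p.2 + 1) x y) z
    + ω (p.1 + 1) (ω (p.2 + 1) y z) x + ω (p.1 + 1) (ω (p.2 + 1) z x) y) rfl fun p hp => by
      have h₁ := HasAntidiagonal.antidiagonal.fst_le hp
      have h₂ := HasAntidiagonal.antidiagonal.snd_le hp
      simp [hne (show p.1 + 1 < n + 2 by omega), hne (show p.2 + 1 < n + 2 by omega)]]
  simp [hω]
  abel

theorem leibnizDefectCoeff_update {n : ℕ} (hω : ω (n + 2) = 0) (hφ : φ (n + 2) = 0)
    (f : M →ₗ[R] M →ₗ[R] M) (h : M →ₗ[R] M) (x y : M) :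
    leibnizDefectCoeff (Function.update ω (n + 2) f) (Function.update φ (n + 2) h) (n + 2) x y =
      leibnizDefectCoeff ω φ (n + 2) x y
        + (φ 0 (f x y) - f (φ 0 x) y - f x (φ 0 y))
        + (h (ω 0 x y) - ω 0 (h x) y - ω 0 x (h y)) := by
  have hne {i : ℕ} (hi : i < n + 2) : Function.update ω (n + 2) f i = ω i :=
    Function.update_of_ne hi.ne _ _
  have hne' {i : ℕ} (hi : i < n + 2) : Function.update φ (n + 2) h i = φ i :=
    Function.update_of_ne hi.ne _ _
  simp only [leibnizDefectCoeff_apply, Nat.antidiagonal_succ_succ', sum_cons, sum_map]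
  rw [sum_congr (g := fun p => φ (p.1 + 1) (ω (p.2 + 1) x y)
    - ω (p.2 + 1) (φ (p.1 + 1) x) y - ω (p.2 + 1) x (φ (p.1 + 1) y)) rfl fun p hp => by
      have h₁ := HasAntidiagonal.antidiagonal.fst_le hp
      have h₂ := HasAntidiagonal.antidiagonal.snd_le hp
      simp [hne' (show p.1 + 1 < n + 2 by omega), hne (show p.2 + 1 < n + 2 by omega)]]
  simp [hω, hφ]
  abel

/-- The pair `(∑ i, t ^ i • ω i, ∑ i, t ^ i • φ i)` has degree less than `n` and satisfies the
deformation equations modulo `t ^ n`. -/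
structure IsTruncatedDeformation (ω : ℕ → M →ₗ[R] M →ₗ[R] M) (φ : ℕ → M →ₗ[R] M) (n : ℕ) :
    Prop where
  skew : ∀ i x y, ω i x y = -ω i y x
  jacobiator : ∀ m < n, jacobiatorCoeff ω m = 0
  leibniz : ∀ m < n, leibnizDefectCoeff ω φ m = 0
  bracket_eq_zero : ∀ m, n ≤ m → ω m = 0
  derivation_eq_zero : ∀ m, n ≤ m → φ m = 0

/-- A truncated deformation whose obstruction is the coboundary of `(f, h)` extends by `(f, h)`. -/
theorem IsTruncatedDeformation.update {n : ℕ} (H : IsTruncatedDeformation ω φ (n + 2))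
    {f : M →ₗ[R] M →ₗ[R] M} {h : M →ₗ[R] M} (hf : ∀ x y, f x y = -f y x)
    (hJ : ∀ x y z, jacobiatorCoeff ω (n + 2) x y z =
      ω 0 x (f y z) - ω 0 y (f x z) + ω 0 z (f x y)
        - f (ω 0 x y) z + f (ω 0 x z) y - f (ω 0 y z) x)
    (hD : ∀ x y, leibnizDefectCoeff ω φ (n + 2) x y =
      (ω 0 x (h y) - ω 0 y (h x) - h (ω 0 x y)) + (f (φ 0 x) y + f x (φ 0 y) - φ 0 (f x y))) :
    IsTruncatedDeformation (Function.update ω (n + 2) f) (Function.update φ (n + 2) h)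
      (n + 3) where
  skew i x y := by
    rcases eq_or_ne i (n + 2) with rfl | hi
    · simpa using hf x y
    · simpa [hi] using H.skew i x y
  jacobiator m hm := by
    rcases (Nat.lt_succ_iff.mp hm).eq_or_lt with rfl | hm
    · ext x y z
      rw [jacobiatorCoeff_update (H.bracket_eq_zero _ le_rfl), hJ, H.skew 0 (f x y) z,
        H.skew 0 (f y z) x, H.skew 0 (f z x) y, hf z x, H.skew 0 z x]
      simp only [map_neg, LinearMap.neg_apply, LinearMap.zero_apply]
      abel
    · rw [← H.jacobiator m hm]
      exact jacobiatorCoeff_congr fun i hi => Function.update_of_ne (by omega) _ _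
  leibniz m hm := by
    rcases (Nat.lt_succ_iff.mp hm).eq_or_lt with rfl | hm
    · ext x y
      rw [leibnizDefectCoeff_update (H.bracket_eq_zero _ le_rfl) (H.derivation_eq_zero _ le_rfl),
        hD, H.skew 0 (h x) y]
      simp only [LinearMap.zero_apply]
      abel
    · rw [← H.leibniz m hm]
      exact leibnizDefectCoeff_congr (fun i hi => Function.update_of_ne (by omega) _ _)
        fun i hi => Function.update_of_ne (by omega) _ _
  bracket_eq_zero m hm := by
    rw [Function.update_of_ne (by omega), H.bracket_eq_zero m (by omega)]
  derivation_eq_zero m hm := by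
    rw [Function.update_of_ne (by omega), H.derivation_eq_zero m (by omega)]

/-- If truncated deformations can be extended order by order, then they extend to full ones. -/
theorem IsTruncatedDeformation.exists_deformation
    {ω₀ : ℕ → M →ₗ[R] M →ₗ[R] M} {φ₀ : ℕ → M →ₗ[R] M} (H₀ : IsTruncatedDeformation ω₀ φ₀ 2)
    (step : ∀ n ω φ, ω 0 = ω₀ 0 → φ 0 = φ₀ 0 → IsTruncatedDeformation ω φ (n + 2) →
      ∃ f h, IsTruncatedDeformation (Function.update ω (n + 2) f)
        (Function.update φ (n + 2) h) (n + 3)) :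
    ∃ (ω : ℕ → M →ₗ[R] M →ₗ[R] M) (φ : ℕ → M →ₗ[R] M),
      (∀ i < 2, ω i = ω₀ i) ∧ (∀ i < 2, φ i = φ₀ i) ∧ (∀ i x y, ω i x y = -ω i y x) ∧
      (∀ n, jacobiatorCoeff ω n = 0) ∧ ∀ n, leibnizDefectCoeff ω φ n = 0 := by
  choose! f h hstep using step
  let S : ℕ → (ℕ → M →ₗ[R] M →ₗ[R] M) × (ℕ → M →ₗ[R] M) := fun n =>
    Nat.rec (ω₀, φ₀) (fun n s =>
      (Function.update s.1 (n + 2) (f n s.1 s.2), Function.update s.2 (n + 2) (h n s.1 s.2))) n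
  have stable {n m i : ℕ} (hnm : n ≤ m) (hi : i < n + 2) :
      (S m).1 i = (S n).1 i ∧ (S m).2 i = (S n).2 i := by
    induction m, hnm using Nat.le_induction with
    | base => exact ⟨rfl, rfl⟩
    | succ m hm ih =>
      rw [← ih.1, ← ih.2]
      exact ⟨Function.update_of_ne (by omega) _ _, Function.update_of_ne (by omega) _ _⟩
  have hS (n : ℕ) : IsTruncatedDeformation (S n).1 (S n).2 (n + 2) := by
    induction n with
    | zero => exact H₀
    | succ n ih =>
      have h0 := stable (Nat.zero_le n) (show 0 < 0 + 2 by omega)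
      exact hstep n _ _ h0.1 h0.2 ih
  refine ⟨fun i => (S i).1 i, fun i => (S i).2 i, fun i hi => (stable (Nat.zero_le i) hi).1,
    fun i hi => (stable (Nat.zero_le i) hi).2, fun i => (hS i).skew i, fun n => ?_, fun n => ?_⟩
  · rw [← (hS n).jacobiator n (by omega)]
    exact jacobiatorCoeff_congr fun i hi => (stable hi (by omega)).1.symm
  · rw [← (hS n).leibniz n (by omega)]
    exact leibnizDefectCoeff_congr (fun i hi => (stable hi (by omega)).1.symm)
      fun i hi => (stable hi (by omega)).2.symm

end FormalDeformation

/-- Let `(g, φ)` be a LieDer pair over a field `K` of characteristic `0`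
with bracket `ω`.  If the third LieDer cohomology with adjoint coefficients vanishes
(every 3-cocycle `(F, G)` is of the form `(d f, d h + δ f)`), then every 2-cocycle
`(ω₁, φ₁)` of `(g, φ)` with adjoint coefficients is the infinitesimal of some
1-parameter formal deformation of `(g, φ)`. -/
theorem cocycle_is_infinitesimal_of_H3_trivial {K g : Type*} [Field K] [CharZero K]
    [LieRing g] [LieAlgebra K g]
    (φ : g →ₗ[K] g) (hφ : ∀ x y : g, φ ⁅x, y⁆ = ⁅φ x, y⁆ + ⁅x, φ y⁆)
    -- H³_{LieDer}(g;g) = 0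
    (hH3 : ∀ F : g →ₗ[K] g →ₗ[K] g →ₗ[K] g,
      (∀ x y z : g, F x y z = - F y x z) → (∀ x y z : g, F x z y = - F x y z) →
      ∀ G : g →ₗ[K] g →ₗ[K] g, (∀ x y : g, G x y = - G y x) →
      -- d F = 0
      (∀ x y z w : g,
        ⁅x, F y z w⁆ - ⁅y, F x z w⁆ + ⁅z, F x y w⁆ - ⁅w, F x y z⁆
          - F ⁅x, y⁆ z w + F ⁅x, z⁆ y w - F ⁅x, w⁆ y z
          - F ⁅y, z⁆ x w + F ⁅y, w⁆ x z - F ⁅z, w⁆ x y = 0) →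
      -- d G − δ F = 0
      (∀ x y z : g,
        (⁅x, G y z⁆ - ⁅y, G x z⁆ + ⁅z, G x y⁆
          - G ⁅x, y⁆ z + G ⁅x, z⁆ y - G ⁅y, z⁆ x)
          - (F (φ x) y z + F x (φ y) z + F x y (φ z) - φ (F x y z)) = 0) →
      -- then (F, G) = (d f, d h + δ f) for some 2-cochain (f, h)
      ∃ (f : g →ₗ[K] g →ₗ[K] g) (h : g →ₗ[K] g),
        (∀ x y : g, f x y = - f y x) ∧
        (∀ x y z : g, F x y z =
          ⁅x, f y z⁆ - ⁅y, f x z⁆ + ⁅z, f x y⁆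
            - f ⁅x, y⁆ z + f ⁅x, z⁆ y - f ⁅y, z⁆ x) ∧
        (∀ x y : g, G x y =
          (⁅x, h y⁆ - ⁅y, h x⁆ - h ⁅x, y⁆)
            + (f (φ x) y + f x (φ y) - φ (f x y))))
    -- a 2-cocycle (ω₁, φ₁)
    (ω₁ : g →ₗ[K] g →ₗ[K] g) (hω₁skew : ∀ x y : g, ω₁ x y = - ω₁ y x)
    (φ₁ : g →ₗ[K] g)
    (hc1 : ∀ x y z : g,
      ⁅x, ω₁ y z⁆ - ⁅y, ω₁ x z⁆ + ⁅z, ω₁ x y⁆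
        - ω₁ ⁅x, y⁆ z + ω₁ ⁅x, z⁆ y - ω₁ ⁅y, z⁆ x = 0)
    (hc2 : ∀ x y : g,
      (⁅x, φ₁ y⁆ - ⁅y, φ₁ x⁆ - φ₁ ⁅x, y⁆)
        + (ω₁ (φ x) y + ω₁ x (φ y) - φ (ω₁ x y)) = 0) :
    -- (ω₁, φ₁) is the infinitesimal of a 1-parameter formal deformation
    ∃ (ω : ℕ → g →ₗ[K] g →ₗ[K] g) (φd : ℕ → g →ₗ[K] g),
      (∀ x y : g, ω 0 x y = ⁅x, y⁆) ∧ ω 1 = ω₁ ∧ φd 0 = φ ∧ φd 1 = φ₁ ∧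
      (∀ (i : ℕ) (x y : g), ω i x y = - ω i y x) ∧
      (∀ (n : ℕ) (x y z : g),
        ∑ i ∈ Finset.range (n + 1),
          (ω i (ω (n - i) x y) z + ω i (ω (n - i) y z) x + ω i (ω (n - i) z x) y) = 0) ∧
      (∀ (n : ℕ) (x y : g),
        ∑ i ∈ Finset.range (n + 1),
          (φd i (ω (n - i) x y) - ω (n - i) (φd i x) y - ω (n - i) x (φd i y)) = 0) := by
  let ω₀ : ℕ → g →ₗ[K] g →ₗ[K] g
    | 0 => (LieModule.toEnd K g g : g →ₗ[K] g →ₗ[K] g)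
    | 1 => ω₁
    | _ + 2 => 0
  let φ₀ : ℕ → g →ₗ[K] g
    | 0 => φ
    | 1 => φ₁
    | _ + 2 => 0
  have hbr (x y : g) : ω₀ 0 x y = ⁅x, y⁆ := rfl
  have H₀ : IsTruncatedDeformation ω₀ φ₀ 2 := by
    refine ⟨?_, ?_, ?_, ?_, ?_⟩
    · rintro (_ | _ | i) x y
      · simp only [hbr, lie_skew]
      · exact hω₁skew x y
      · simp [ω₀]
    · intro m hm
      ext x y z
      interval_cases m
      · simp only [jacobiatorCoeff_apply, Finset.Nat.antidiagonal_zero, Finset.sum_singleton, hbr,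
          LinearMap.zero_apply]
        rw [← neg_eq_zero, ← lie_jacobi x y z, ← lie_skew x ⁅y, z⁆, ← lie_skew y ⁅z, x⁆,
          ← lie_skew z ⁅x, y⁆]
        abel
      · have hc := hc1 x y z
        have e : ω₀ 1 = ω₁ := rfl
        simp only [jacobiatorCoeff_apply, Finset.Nat.sum_antidiagonal_succ,
          Finset.Nat.antidiagonal_zero, Finset.sum_singleton, hbr, zero_add, e,
          LinearMap.zero_apply]
        rw [← neg_eq_zero, ← hc, ← lie_skew z (ω₁ x y), ← lie_skew x (ω₁ y z),
          ← lie_skew y (ω₁ x z), hω₁skew z x, ← lie_skew x z]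
        simp only [map_neg, LinearMap.neg_apply, neg_lie]
        abel
    · intro m hm
      ext x y
      have e : φ₀ 0 = φ := rfl
      interval_cases m
      · simp [leibnizDefectCoeff_apply, hbr, e, hφ]
      · have hc := hc2 x y
        have e₁ : ω₀ 1 = ω₁ := rfl
        have e₂ : φ₀ 1 = φ₁ := rfl
        simp only [leibnizDefectCoeff_apply, Finset.Nat.sum_antidiagonal_succ,
          Finset.Nat.antidiagonal_zero, Finset.sum_singleton, hbr, zero_add, e, e₁, e₂,
          LinearMap.zero_apply]
        rw [← neg_eq_zero, ← hc, ← lie_skew (φ₁ x) y]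
        abel
    · rintro (_ | _ | m) hm
      · omega
      · omega
      · rfl
    · rintro (_ | _ | m) hm
      · omega
      · omega
      · rfl
  obtain ⟨ω, φd, hω, hφd, hskew, hJ, hD⟩ := H₀.exists_deformation fun n ω ψ hω0 hψ0 H => by
    have hb (x y : g) : ω 0 x y = ⁅x, y⁆ := by rw [hω0, hbr]
    have hψ : ψ 0 = φ := hψ0
    obtain ⟨f, h, hf, hF, hG⟩ := hH3 (jacobiatorCoeff ω (n + 2))
      (jacobiatorCoeff_swap_left H.skew _) (jacobiatorCoeff_swap_right H.skew _)
      (leibnizDefectCoeff ω ψ (n + 2)) (leibnizDefectCoeff_swap H.skew _)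
      (by simpa only [hb] using jacobiatorCoeff_cocycle H.skew H.jacobiator)
      (by simpa only [hb, hψ] using leibnizDefectCoeff_cocycle H.skew H.jacobiator H.leibniz)
    exact ⟨f, h, H.update hf (by simpa only [hb] using hF) (by simpa only [hb, hψ] using hG)⟩
  refine ⟨ω, φd, fun x y => by rw [hω 0 two_pos, hbr], hω 1 one_lt_two, hφd 0 two_pos,
    hφd 1 one_lt_two, hskew, fun n x y z => ?_, fun n x y => ?_⟩
  · rw [← Finset.Nat.sum_antidiagonal_eq_sum_range_succ (fun i j =>
      ω i (ω j x y) z + ω i (ω j y z) x + ω i (ω j z x) y), ← jacobiatorCoeff_apply, hJ]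
    rfl
  · rw [← Finset.Nat.sum_antidiagonal_eq_sum_range_succ (fun i j =>
      φd i (ω j x y) - ω j (φd i x) y - ω j x (φd i y)), ← leibnizDefectCoeff_apply, hD]
    rfl
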